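/- Let T = ⊕_{i∈I} 𝒪_i : (∑_{i∈I} ⊕ V_i)_{ℓ²} → (∑_{i∈I} ⊕ W_i)_{ℓ²} be a bounded block diagonal operator with components 𝒪_i ∈ B(V_i, W_i), and assume that T has closed range. Then (a) the range of T equals (∑_{i∈I} ⊕ ran 𝒪_i)_{ℓ²}, i.e. g ∈ ran T if and only if g ∈ (∑_{i∈I} ⊕ W_i)_{ℓ²} and g_i ∈ ran 𝒪_i for every i ∈ I; and (b) 𝒪_i has closed range for every i ∈ I. -/

import Mathlib

/-- If a bounded block diagonal operator `T = ⊕ᵢ Oᵢ` between Hilbert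
direct sums has closed range, then (a) the range of `T` equals the ℓ²-sum of the ranges
of the components (`g ∈ ran T` iff `g i ∈ ran (O i)` for every `i`), and (b) every
component `Oᵢ` has closed range. -/
theorem stmt8 {I : Type*} [Countable I] (V W : I → Type*)
    [∀ i, NormedAddCommGroup (V i)] [∀ i, InnerProductSpace ℂ (V i)] [∀ i, CompleteSpace (V i)]
    [∀ i, NormedAddCommGroup (W i)] [∀ i, InnerProductSpace ℂ (W i)] [∀ i, CompleteSpace (W i)]
    (O : ∀ i, V i →L[ℂ] W i)
    (T : lp V 2 →L[ℂ] lp W 2) (hT : ∀ (f : lp V 2) (i : I), T f i = O i (f i))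
    (hclosed : IsClosed (Set.range T)) :
    (∀ g : lp W 2, g ∈ Set.range T ↔ ∀ i, g i ∈ Set.range (O i)) ∧
    ∀ i, IsClosed (Set.range (O i)) := by
  classical
  have hsingle (i : I) (v : V i) : T (lp.single 2 i v) = lp.single 2 i (O i v) := by
    ext j
    rw [hT]
    obtain rfl | hij := eq_or_ne j i
    · simp only [lp.single_apply_self]
    · simp only [lp.single_apply_ne _ _ _ hij, map_zero]
  refine ⟨fun g => ⟨?_, fun hg => ?_⟩, fun i => ?_⟩
  · rintro ⟨f, rfl⟩ i
    exact ⟨f i, (hT f i).symm⟩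
  · refine hclosed.mem_of_tendsto (lp.hasSum_single (by simp) g)
      (Filter.Eventually.of_forall fun s => ?_)
    choose v hv using hg
    exact ⟨∑ i ∈ s, lp.single 2 i (v i), by simp only [map_sum, hsingle, hv]⟩
  · have hpre : Set.range (O i) = lp.single (E := W) 2 i ⁻¹' Set.range T := by
      ext w
      constructor
      · rintro ⟨v, rfl⟩
        exact ⟨_, hsingle i v⟩
      · rintro ⟨f, hf⟩
        exact ⟨f i, by rw [← hT, hf, lp.single_apply_self]⟩
    rw [hpre]
    exact hclosed.preimage (lp.isometry_single i).continuous
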